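/- arXiv:2410.08056 — 3 statements merged into one kernel-verified Lean document; each statement's English description precedes it below -/
import Mathlib

section
/- For every t ∈ [0,1), the generalized Cesàro operator C_t maps the disc algebra A(𝔻) continuously into itself. Moreover, its operator norm satisfies ‖C_0‖_{A(𝔻)→A(𝔻)} = 1, and for every t ∈ (0,1), ‖C_t‖_{A(𝔻)→A(𝔻)} = (−log(1−t))/t. -/
open Complex MeasureTheory Metric Set Filter Topology

/-- The generalized Cesàro operator `C_t`, given by
`(C_t f)(z) = ∫_0^1 f(sz)/(1 - s t z) ds`, which equals `f(0)` at `z = 0` and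
`(1/z)∫_0^z f(ξ)/(1 - tξ) dξ` for `z ≠ 0`. -/
noncomputable def cesaro (t : ℝ) (f : ℂ → ℂ) (z : ℂ) : ℂ :=
  ∫ s in (0:ℝ)..1, f ((s : ℂ) * z) / (1 - (s : ℂ) * (t : ℂ) * z)

/-- The sup norm `‖f‖_∞ = sup_{z ∈ 𝔻} |f z|`. -/
noncomputable def supNorm (f : ℂ → ℂ) : ℝ :=
  sSup ((fun z => ‖f z‖) '' Metric.ball (0:ℂ) 1)

/-- Membership in the disc algebra `A(𝔻)`: holomorphic on the open unit disc and
continuous on the closed unit disc (i.e. extends continuously to the closed disc). -/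
def MemDiscAlg (f : ℂ → ℂ) : Prop :=
  DifferentiableOn ℂ f (Metric.ball (0:ℂ) 1) ∧ ContinuousOn f (Metric.closedBall (0:ℂ) 1)

/-- Multiplication by a real `s ∈ [0, 1]` does not leave a closed ball around `0`. -/
lemma ofReal_mul_mem_closedBall {r s : ℝ} {z : ℂ} (hs : s ∈ Icc (0 : ℝ) 1)
    (hz : z ∈ closedBall (0 : ℂ) r) : (s : ℂ) * z ∈ closedBall (0 : ℂ) r := by
  rw [mem_closedBall_zero_iff] at hz ⊢
  rw [norm_mul, Complex.norm_real, Real.norm_of_nonneg hs.1]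
  exact (mul_le_of_le_one_left (norm_nonneg z) hs.2).trans hz

lemma ofReal_mul_mem_ball {r s : ℝ} {z : ℂ} (hs : s ∈ Icc (0 : ℝ) 1)
    (hz : z ∈ ball (0 : ℂ) r) : (s : ℂ) * z ∈ ball (0 : ℂ) r := by
  rw [mem_ball_zero_iff] at hz ⊢
  rw [norm_mul, Complex.norm_real, Real.norm_of_nonneg hs.1]
  exact (mul_le_of_le_one_left (norm_nonneg z) hs.2).trans_lt hz

lemma continuousOn_comp_ofReal_mul {r : ℝ} {G : ℂ → ℂ} {z : ℂ}
    (hG : ContinuousOn G (closedBall (0 : ℂ) r)) (hz : z ∈ closedBall (0 : ℂ) r) :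
    ContinuousOn (fun s : ℝ => G (s * z)) (Icc (0 : ℝ) 1) :=
  hG.comp (by fun_prop) fun _ hs => ofReal_mul_mem_closedBall hs hz

lemma continuousOn_integral_ray {r : ℝ} {G : ℂ → ℂ}
    (hG : ContinuousOn G (closedBall (0 : ℂ) r)) :
    ContinuousOn (fun z : ℂ => ∫ s in (0 : ℝ)..1, G (s * z)) (closedBall (0 : ℂ) r) := by
  obtain ⟨C, hC⟩ := (isCompact_closedBall (0 : ℂ) r).exists_bound_of_continuousOn hG
  have hsub : uIoc (0 : ℝ) 1 ⊆ Icc 0 1 := by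
    rw [uIoc_of_le zero_le_one]
    exact Ioc_subset_Icc_self
  intro z hz
  refine intervalIntegral.continuousWithinAt_of_dominated_interval (bound := fun _ => C)
    ?_ ?_ intervalIntegrable_const ?_
  · filter_upwards [self_mem_nhdsWithin] with w hw
    exact ((continuousOn_comp_ofReal_mul hG hw).mono hsub).aestronglyMeasurable
      measurableSet_uIoc
  · filter_upwards [self_mem_nhdsWithin] with w hw
    exact Eventually.of_forall fun s hs => hC _ (ofReal_mul_mem_closedBall (hsub hs) hw)
  · refine Eventually.of_forall fun s hs => ?_
    have hcomp : ContinuousOn (fun w : ℂ => G (s * w)) (closedBall (0 : ℂ) r) :=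
      hG.comp (by fun_prop) fun w hw => ofReal_mul_mem_closedBall (hsub hs) hw
    exact hcomp z hz

/-- The average along rays of a holomorphic function is the slope at `0` of a primitive. -/
lemma differentiableOn_integral_ray {r : ℝ} {G : ℂ → ℂ}
    (hG : DifferentiableOn ℂ G (ball (0 : ℂ) r)) :
    DifferentiableOn ℂ (fun z : ℂ => ∫ s in (0 : ℝ)..1, G (s * z)) (ball (0 : ℂ) r) := by
  rcases le_or_gt r 0 with hr | hr
  · rw [ball_eq_empty.2 hr]
    exact differentiableOn_empty
  obtain ⟨H, hH⟩ := hG.isExactOn_ball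
  have hHd : DifferentiableOn ℂ H (ball (0 : ℂ) r) := fun z hz =>
    (hH z hz).differentiableAt.differentiableWithinAt
  refine ((differentiableOn_dslope (isOpen_ball.mem_nhds (mem_ball_self hr))).2 hHd).congr
    fun z hz => ?_
  rcases eq_or_ne z 0 with rfl | hz0
  · simp [dslope_same, (hH 0 (mem_ball_self hr)).deriv]
  have hderiv : ∀ s ∈ uIcc (0 : ℝ) 1,
      HasDerivAt (fun s : ℝ => H (s * z) / z) (G (s * z)) s := by
    intro s hs
    rw [uIcc_of_le zero_le_one] at hs
    have hmul : HasDerivAt (fun s : ℝ => (s : ℂ) * z) z s := by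
      simpa using (Complex.ofRealCLM.hasDerivAt (x := s)).mul_const z
    have h := ((hH _ (ofReal_mul_mem_ball hs hz)).comp s hmul).div_const z
    simpa [hz0, Function.comp_def] using h
  have hcont : ContinuousOn (fun s : ℝ => G (s * z)) (uIcc (0 : ℝ) 1) := by
    rw [uIcc_of_le zero_le_one]
    exact hG.continuousOn.comp (by fun_prop) fun s hs => ofReal_mul_mem_ball hs hz
  rw [intervalIntegral.integral_eq_sub_of_hasDerivAt hderiv hcont.intervalIntegrable,
    dslope_of_ne _ hz0, slope_def_field]
  simp [sub_div]

lemma cesaro_eq_integral_ray (t : ℝ) (f : ℂ → ℂ) :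
    cesaro t f = fun z => ∫ s in (0 : ℝ)..1, (fun w => f w / (1 - t * w)) (s * z) := by
  funext z
  refine intervalIntegral.integral_congr fun s _ => ?_
  simp only
  congr 2
  ring

lemma one_sub_mul_pos {t s : ℝ} (ht0 : 0 ≤ t) (ht1 : t < 1) (hs : s ∈ Icc (0 : ℝ) 1) :
    0 < 1 - s * t := by
  nlinarith [hs.1, hs.2]

lemma one_sub_mul_le_norm {t s : ℝ} (ht0 : 0 ≤ t) (hs : 0 ≤ s) {z : ℂ}
    (hz : z ∈ closedBall (0 : ℂ) 1) : 1 - s * t ≤ ‖1 - (s : ℂ) * (t : ℂ) * z‖ := by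
  rw [mem_closedBall_zero_iff] at hz
  have hnorm : ‖(s : ℂ) * (t : ℂ) * z‖ ≤ s * t := by
    rw [norm_mul, norm_mul, Complex.norm_real, Complex.norm_real, Real.norm_of_nonneg hs,
      Real.norm_of_nonneg ht0]
    exact mul_le_of_le_one_right (mul_nonneg hs ht0) hz
  have htri := norm_sub_norm_le (1 : ℂ) ((s : ℂ) * (t : ℂ) * z)
  rw [norm_one] at htri
  linarith

lemma MemDiscAlg.cesaro {t : ℝ} (ht0 : 0 ≤ t) (ht1 : t < 1) {f : ℂ → ℂ}
    (hf : MemDiscAlg f) : MemDiscAlg (cesaro t f) := by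
  have hne : ∀ w ∈ closedBall (0 : ℂ) 1, 1 - (t : ℂ) * w ≠ 0 := fun w hw => by
    have h := one_sub_mul_le_norm ht0 zero_le_one hw
    simp only [ofReal_one, one_mul] at h
    exact norm_pos_iff.1 (by linarith)
  rw [cesaro_eq_integral_ray]
  exact ⟨differentiableOn_integral_ray (hf.1.div (by fun_prop) fun w hw =>
      hne w (ball_subset_closedBall hw)),
    continuousOn_integral_ray (hf.2.div (by fun_prop) hne)⟩

lemma memDiscAlg_one : MemDiscAlg fun _ => 1 :=
  ⟨differentiableOn_const _, continuousOn_const⟩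

lemma supNorm_const (c : ℂ) : supNorm (fun _ => c) = ‖c‖ := by
  simp [supNorm, (nonempty_ball.2 one_pos : (ball (0 : ℂ) 1).Nonempty).image_const]

lemma supNorm_le {f : ℂ → ℂ} {C : ℝ} (h : ∀ z ∈ ball (0 : ℂ) 1, ‖f z‖ ≤ C) :
    supNorm f ≤ C :=
  csSup_le ((nonempty_ball.2 one_pos).image _) (forall_mem_image.2 h)

lemma MemDiscAlg.norm_le_supNorm {f : ℂ → ℂ} (hf : MemDiscAlg f) {z : ℂ}
    (hz : z ∈ closedBall (0 : ℂ) 1) : ‖f z‖ ≤ supNorm f := by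
  obtain ⟨C, hC⟩ := (isCompact_closedBall (0 : ℂ) 1).exists_bound_of_continuousOn hf.2
  have hbdd : BddAbove ((fun z => ‖f z‖) '' ball (0 : ℂ) 1) :=
    ⟨C, forall_mem_image.2 fun w hw => hC w (ball_subset_closedBall hw)⟩
  rw [← closure_ball (0 : ℂ) one_ne_zero] at hz
  refine le_on_closure (g := fun _ => supNorm f)
    (fun w hw => le_csSup hbdd (mem_image_of_mem _ hw)) ?_ continuousOn_const hz
  rw [closure_ball (0 : ℂ) one_ne_zero]
  exact hf.2.norm

lemma intervalIntegrable_inv_one_sub_mul {t : ℝ} (ht0 : 0 ≤ t) (ht1 : t < 1) :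
    IntervalIntegrable (fun s : ℝ => (1 - s * t)⁻¹) volume 0 1 := by
  refine ContinuousOn.intervalIntegrable (ContinuousOn.inv₀ (by fun_prop) fun s hs => ?_)
  rw [uIcc_of_le zero_le_one] at hs
  exact (one_sub_mul_pos ht0 ht1 hs).ne'

lemma integral_inv_one_sub_mul {t : ℝ} (ht0 : 0 < t) (ht1 : t < 1) :
    ∫ s in (0 : ℝ)..1, (1 - s * t)⁻¹ = -Real.log (1 - t) / t := by
  have hderiv : ∀ s ∈ uIcc (0 : ℝ) 1,
      HasDerivAt (fun s : ℝ => -Real.log (1 - s * t) / t) (1 - s * t)⁻¹ s := by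
    intro s hs
    rw [uIcc_of_le zero_le_one] at hs
    have hpos := one_sub_mul_pos ht0.le ht1 hs
    have h := (((((hasDerivAt_id s).mul_const t).const_sub 1).log hpos.ne').neg).div_const t
    refine h.congr_deriv ?_
    simp only [id]
    field_simp
  rw [intervalIntegral.integral_eq_sub_of_hasDerivAt hderiv
    (intervalIntegrable_inv_one_sub_mul ht0.le ht1)]
  simp

lemma supNorm_cesaro_le {t : ℝ} (ht0 : 0 ≤ t) (ht1 : t < 1) {f : ℂ → ℂ}
    (hf : MemDiscAlg f) :
    supNorm (cesaro t f) ≤ (∫ s in (0 : ℝ)..1, (1 - s * t)⁻¹) * supNorm f := by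
  refine supNorm_le fun z hz => ?_
  have hz' := ball_subset_closedBall hz
  rw [← intervalIntegral.integral_mul_const]
  refine intervalIntegral.norm_integral_le_of_norm_le zero_le_one
    (Eventually.of_forall fun s hs => ?_)
    ((intervalIntegrable_inv_one_sub_mul ht0 ht1).mul_const _)
  have hs' := Ioc_subset_Icc_self hs
  have hpos := one_sub_mul_pos ht0 ht1 hs'
  have hnum := hf.norm_le_supNorm (ofReal_mul_mem_closedBall hs' hz')
  have hden := one_sub_mul_le_norm ht0 hs'.1 hz'
  rw [norm_div, inv_mul_eq_div]
  exact div_le_div₀ ((norm_nonneg _).trans hnum) hnum hpos hden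

lemma cesaro_one_apply_one (t : ℝ) :
    cesaro t (fun _ => 1) 1 = ((∫ s in (0 : ℝ)..1, (1 - s * t)⁻¹ : ℝ) : ℂ) := by
  rw [cesaro, ← intervalIntegral.integral_ofReal]
  simp

/-- The constant function `1` is extremal for `cesaro t`. -/
lemma isLUB_supNorm_cesaro {t : ℝ} (ht0 : 0 ≤ t) (ht1 : t < 1) :
    IsLUB {r : ℝ | ∃ f, MemDiscAlg f ∧ supNorm f ≤ 1 ∧ r = supNorm (cesaro t f)}
      (∫ s in (0 : ℝ)..1, (1 - s * t)⁻¹) := by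
  have hnonneg : 0 ≤ ∫ s in (0 : ℝ)..1, (1 - s * t)⁻¹ :=
    intervalIntegral.integral_nonneg zero_le_one fun s hs =>
      (inv_pos.2 (one_sub_mul_pos ht0 ht1 hs)).le
  refine IsGreatest.isLUB ⟨⟨fun _ => 1, memDiscAlg_one, by simp [supNorm_const], ?_⟩, ?_⟩
  · refine le_antisymm ?_ ?_
    · have h := (memDiscAlg_one.cesaro ht0 ht1).norm_le_supNorm (z := 1) (by simp)
      rwa [cesaro_one_apply_one, Complex.norm_real, Real.norm_of_nonneg hnonneg] at h
    · simpa [supNorm_const] using supNorm_cesaro_le ht0 ht1 memDiscAlg_one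
  · rintro _ ⟨f, hf, hf1, rfl⟩
    exact (supNorm_cesaro_le ht0 ht1 hf).trans (mul_le_of_le_one_right hnonneg hf1)

/-- For each `t ∈ [0,1)` the generalized Cesàro operator maps the disc algebra
continuously into itself; its operator norm is `1` for `t = 0` and
`(-log(1-t))/t` for `t ∈ (0,1)`. -/
theorem cesaro_discAlg_continuous_and_norm (t : ℝ) (ht0 : 0 ≤ t) (ht1 : t < 1) :
    (∀ f, MemDiscAlg f → MemDiscAlg (cesaro t f)) ∧
    (∃ C : ℝ, ∀ f, MemDiscAlg f → supNorm (cesaro t f) ≤ C * supNorm f) ∧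
    (t = 0 →
      IsLUB {r : ℝ | ∃ f, MemDiscAlg f ∧ supNorm f ≤ 1 ∧ r = supNorm (cesaro t f)} 1) ∧
    (0 < t →
      IsLUB {r : ℝ | ∃ f, MemDiscAlg f ∧ supNorm f ≤ 1 ∧ r = supNorm (cesaro t f)}
        (-Real.log (1 - t) / t)) := by
  refine ⟨fun f hf => hf.cesaro ht0 ht1, ⟨_, fun f hf => supNorm_cesaro_le ht0 ht1 hf⟩,
    fun h => ?_, fun h => ?_⟩
  · simpa [h] using isLUB_supNorm_cesaro ht0 ht1
  · rw [← integral_inv_one_sub_mul h ht1]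
    exact isLUB_supNorm_cesaro ht0 ht1
end

section
/- For every t ∈ [0,1), both the operator C_t : H^∞ → H^∞ and the operator C_t : A(𝔻) → A(𝔻) are compact, i.e., each maps the closed unit ball to a relatively compact set. -/
open Complex MeasureTheory Metric Set Filter Topology

/-- Membership in `H^∞`: holomorphic and bounded on the open unit disc. -/
def MemHinf (f : ℂ → ℂ) : Prop :=
  DifferentiableOn ℂ f (Metric.ball (0:ℂ) 1) ∧
    BddAbove ((fun z => ‖f z‖) '' Metric.ball (0:ℂ) 1)

lemma one_sub_le_norm_one_sub_mul {t s : ℝ} {z : ℂ} (ht0 : 0 ≤ t) (hs0 : 0 ≤ s) (hs1 : s ≤ 1)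
    (hz : ‖z‖ ≤ 1) : 1 - t ≤ ‖1 - (s : ℂ) * (t : ℂ) * z‖ := by
  have h1 : ‖(s : ℂ) * (t : ℂ) * z‖ ≤ t := by
    rw [norm_mul, norm_mul, Complex.norm_of_nonneg hs0, Complex.norm_of_nonneg ht0]
    calc s * t * ‖z‖ ≤ 1 * t * 1 := by gcongr
      _ = t := by ring
  have h2 := norm_sub_norm_le (1 : ℂ) ((s : ℂ) * (t : ℂ) * z)
  rw [norm_one] at h2
  linarith

lemma norm_iteratedDeriv_zero_le_factorial {f : ℂ → ℂ} (hf : DifferentiableOn ℂ f (ball 0 1))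
    (hb : ∀ z ∈ ball (0 : ℂ) 1, ‖f z‖ ≤ 1) (k : ℕ) :
    ‖iteratedDeriv k f 0‖ ≤ k.factorial := by
  have hlim : Tendsto (fun R : ℝ => (k.factorial : ℝ) * 1 / R ^ k) (𝓝[Iio 1] 1)
      (𝓝 ((k.factorial : ℝ) * 1 / 1 ^ k)) := by
    refine ContinuousAt.tendsto (x := (1 : ℝ)) ?_ |>.mono_left nhdsWithin_le_nhds
    exact continuousAt_const.div (by fun_prop) (by simp)
  have := ge_of_tendsto (b := ‖iteratedDeriv k f 0‖) hlim ?_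
  · simpa using this
  · filter_upwards [Ioo_mem_nhdsLT (zero_lt_one' ℝ)] with R hR
    refine norm_iteratedDeriv_le_of_forall_mem_sphere_norm_le k hR.1 ?_ ?_
    · refine (hf.mono ?_).diffContOnCl
      exact (closure_ball_subset_closedBall).trans (closedBall_subset_ball hR.2)
    · intro z hz
      exact hb z (closedBall_subset_ball hR.2 (sphere_subset_closedBall hz))

/-- **Montel's theorem** on the unit disc for sequences bounded by one. -/
lemma exists_subseq_tendstoUniformlyOn {f : ℕ → ℂ → ℂ}
    (hf : ∀ n, DifferentiableOn ℂ (f n) (ball 0 1))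
    (hb : ∀ n, ∀ z ∈ ball (0 : ℂ) 1, ‖f n z‖ ≤ 1) :
    ∃ h : ℂ → ℂ, ∃ φ : ℕ → ℕ, StrictMono φ ∧
      ∀ r : ℝ, r < 1 → TendstoUniformlyOn (fun n => f (φ n)) h atTop (closedBall 0 r) := by
  set c : ℕ → ℕ → ℂ := fun n k => (k.factorial : ℂ)⁻¹ * iteratedDeriv k (f n) 0 with hc
  have hc1 : ∀ n k, ‖c n k‖ ≤ 1 := fun n k => by
    have h := norm_iteratedDeriv_zero_le_factorial (hf n) (hb n) k
    have hk : (0 : ℝ) < k.factorial := by positivity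
    rw [hc, norm_mul, norm_inv, Complex.norm_natCast, inv_mul_le_iff₀ hk, mul_one]
    exact h
  obtain ⟨a, ha, φ, hφ, hlim⟩ :=
    (isCompact_univ_pi fun _ : ℕ => isCompact_closedBall (0 : ℂ) 1).tendsto_subseq (x := c)
      fun n k _ => mem_closedBall_zero_iff.2 (hc1 n k)
  have ha1 : ∀ k, ‖a k‖ ≤ 1 := fun k => mem_closedBall_zero_iff.1 (ha k trivial)
  have hck : ∀ k, Tendsto (fun n => c (φ n) k) atTop (𝓝 (a k)) := fun k =>
    (tendsto_pi_nhds.1 hlim) k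
  refine ⟨fun z => ∑' k, a k * z ^ k, φ, hφ, fun r hr => ?_⟩
  rcases lt_or_ge r 0 with hr0 | hr0
  · rw [closedBall_eq_empty.2 hr0]
    exact tendstoUniformlyOn_empty
  have hsum : Summable fun k => 2 * r ^ k := (summable_geometric_of_lt_one hr0 hr).mul_left 2
  have hle : ∀ n k, ‖c n k - a k‖ * r ^ k ≤ 2 * r ^ k := fun n k => by
    gcongr
    linarith [norm_sub_le (c n k) (a k), hc1 n k, ha1 k]
  have hD : Tendsto (fun n => ∑' k, ‖c (φ n) k - a k‖ * r ^ k) atTop (𝓝 0) := by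
    have := tendsto_tsum_of_dominated_convergence (𝓕 := atTop)
      (f := fun n k => ‖c (φ n) k - a k‖ * r ^ k) (g := fun _ => (0 : ℝ)) hsum
      (fun k => ?_) (Eventually.of_forall fun n k => ?_)
    · simpa using this
    · have := ((hck k).sub_const (a k)).norm.mul_const (r ^ k)
      simpa using this
    · rw [Real.norm_of_nonneg (by positivity)]
      exact hle _ k
  rw [Metric.tendstoUniformlyOn_iff]
  intro ε hε
  filter_upwards [hD.eventually_lt_const hε] with n hn z hz
  have hzr : ‖z‖ ≤ r := mem_closedBall_zero_iff.1 hz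
  have hpow : ∀ {b : ℕ → ℂ}, (∀ k, ‖b k‖ ≤ 1) → Summable fun k => b k * z ^ k := fun hb1 =>
    Summable.of_norm_bounded (summable_geometric_of_lt_one hr0 hr) fun k => by
      rw [norm_mul, norm_pow]
      calc _ ≤ 1 * r ^ k := by gcongr; exact hb1 k
        _ = r ^ k := one_mul _
  have hfz : f (φ n) z = ∑' k, c (φ n) k * z ^ k := by
    rw [← taylorSeries_eq_on_ball' (c := 0) (r := 1)
      (mem_ball_zero_iff.2 (hzr.trans_lt hr)) (hf (φ n))]
    simp [hc]
  rw [dist_comm, dist_eq_norm, hfz, ← (hpow (hc1 _)).tsum_sub (hpow ha1)]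
  refine lt_of_le_of_lt (tsum_of_norm_bounded
    (Summable.of_nonneg_of_le (fun k => by positivity) (hle (φ n)) hsum).hasSum fun k => ?_) hn
  rw [← sub_mul, norm_mul, norm_pow]
  gcongr

lemma continuousOn_cesaro_integrand {t : ℝ} (ht0 : 0 ≤ t) (ht1 : t < 1) {h : ℂ → ℂ}
    (hh : DifferentiableOn ℂ h (ball 0 1)) {z : ℂ} (hz : ‖z‖ ≤ 1) {S : Set ℝ}
    (hS : ∀ s ∈ S, 0 ≤ s ∧ s ≤ 1 ∧ ‖(s : ℂ) * z‖ < 1) :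
    ContinuousOn (fun s : ℝ => h ((s : ℂ) * z) / (1 - (s : ℂ) * (t : ℂ) * z)) S := by
  refine ContinuousOn.div ?_ (by fun_prop) fun s hs h0 => ?_
  · exact hh.continuousOn.comp (by fun_prop) fun s hs => mem_ball_zero_iff.2 (hS s hs).2.2
  · have := one_sub_le_norm_one_sub_mul ht0 (hS s hs).1 (hS s hs).2.1 hz
    rw [h0, norm_zero] at this
    linarith

lemma norm_cesaro_integrand_le {t : ℝ} (ht0 : 0 ≤ t) (ht1 : t < 1) {w z : ℂ} {s C : ℝ}
    (hw : ‖w‖ ≤ C) (hs0 : 0 ≤ s) (hs1 : s ≤ 1) (hz : ‖z‖ ≤ 1) :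
    ‖w / (1 - (s : ℂ) * (t : ℂ) * z)‖ ≤ C / (1 - t) := by
  rw [norm_div]
  have : 0 < 1 - t := sub_pos.2 ht1
  exact div_le_div₀ ((norm_nonneg w).trans hw) hw this
    (one_sub_le_norm_one_sub_mul ht0 hs0 hs1 hz)

lemma norm_ofReal_mul_lt_one {s : ℝ} {z : ℂ} (hs0 : 0 ≤ s) (hs1 : s ≤ 1) (hz : ‖z‖ ≤ 1)
    (h : s < 1 ∨ ‖z‖ < 1) : ‖(s : ℂ) * z‖ < 1 := by
  rw [norm_mul, Complex.norm_of_nonneg hs0]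
  rcases h with h | h <;> nlinarith [norm_nonneg z]

lemma differentiableOn_cesaro {t : ℝ} (ht0 : 0 ≤ t) (ht1 : t < 1) {h : ℂ → ℂ}
    (hh : DifferentiableOn ℂ h (ball 0 1)) : DifferentiableOn ℂ (cesaro t h) (ball 0 1) := by
  have hk : DifferentiableOn ℂ (fun w => h w / (1 - (t : ℂ) * w)) (ball 0 1) := by
    refine hh.div (by fun_prop) fun w hw h0 => ?_
    have := one_sub_le_norm_one_sub_mul (s := 1) ht0 zero_le_one le_rfl (mem_ball_zero_iff.1 hw).le
    rw [ofReal_one, one_mul, h0, norm_zero] at this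
    linarith
  obtain ⟨F, hF⟩ := hk.isExactOn_ball
  have hdF : DifferentiableOn ℂ F (ball 0 1) := fun z hz =>
    (hF z hz).differentiableAt.differentiableWithinAt
  refine ((differentiableOn_dslope (ball_mem_nhds (0 : ℂ) one_pos)).2 hdF).congr fun z hz => ?_
  have hz1 := mem_ball_zero_iff.1 hz
  rcases eq_or_ne z 0 with rfl | hz0
  · rw [dslope_same, (hF 0 hz).deriv]
    simp [cesaro]
  have hmem : ∀ s ∈ uIcc (0 : ℝ) 1, 0 ≤ s ∧ s ≤ 1 ∧ ‖(s : ℂ) * z‖ < 1 := fun s hs => by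
    rw [uIcc_of_le zero_le_one] at hs
    exact ⟨hs.1, hs.2, norm_ofReal_mul_lt_one hs.1 hs.2 hz1.le (Or.inr hz1)⟩
  have hint := intervalIntegral.integral_eq_sub_of_hasDerivAt (a := 0) (b := 1)
    (f := fun s : ℝ => F ((s : ℂ) * z))
    (f' := fun s : ℝ => z * (h ((s : ℂ) * z) / (1 - (s : ℂ) * (t : ℂ) * z)))
    (fun s hs => by
      have h1 := (hF _ (mem_ball_zero_iff.2 (hmem s hs).2.2)).scomp s
        (((hasDerivAt_id s).ofReal_comp).mul_const z)
      refine h1.congr_deriv ?_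
      simp only [ofReal_one, one_mul, smul_eq_mul]
      ring_nf)
    ((continuousOn_const.mul
      (continuousOn_cesaro_integrand ht0 ht1 hh hz1.le hmem)).intervalIntegrable)
  rw [intervalIntegral.integral_const_mul] at hint
  rw [dslope_of_ne _ hz0, slope_def_field, sub_zero, eq_div_iff hz0, mul_comm]
  simpa [cesaro] using hint

lemma continuousOn_cesaro {t : ℝ} (ht0 : 0 ≤ t) (ht1 : t < 1) {h : ℂ → ℂ}
    (hh : DifferentiableOn ℂ h (ball 0 1)) (hb : ∀ z ∈ ball (0 : ℂ) 1, ‖h z‖ ≤ 1) :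
    ContinuousOn (cesaro t h) (closedBall 0 1) := by
  intro z hz
  have hae : ∀ᵐ s : ℝ, s ≠ 1 := by simp [ae_iff]
  have hmem : ∀ w ∈ closedBall (0 : ℂ) 1, ∀ s ∈ Ioo (0 : ℝ) 1,
      0 ≤ s ∧ s ≤ 1 ∧ ‖(s : ℂ) * w‖ < 1 := fun w hw s hs =>
    ⟨hs.1.le, hs.2.le, norm_ofReal_mul_lt_one hs.1.le hs.2.le (mem_closedBall_zero_iff.1 hw)
      (Or.inl hs.2)⟩
  refine intervalIntegral.continuousWithinAt_of_dominated_interval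
    (bound := fun _ => 1 / (1 - t)) ?_ ?_ intervalIntegrable_const ?_
  · filter_upwards [self_mem_nhdsWithin] with w hw
    rw [uIoc_of_le zero_le_one, ← restrict_Ioo_eq_restrict_Ioc]
    exact (continuousOn_cesaro_integrand ht0 ht1 hh (mem_closedBall_zero_iff.1 hw)
      (hmem w hw)).aestronglyMeasurable measurableSet_Ioo
  · filter_upwards [self_mem_nhdsWithin] with w hw
    filter_upwards [hae] with s hs1 hs
    rw [uIoc_of_le zero_le_one] at hs
    have hs' : s ∈ Ioo (0 : ℝ) 1 := ⟨hs.1, lt_of_le_of_ne hs.2 hs1⟩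
    exact norm_cesaro_integrand_le ht0 ht1 (hb _ (mem_ball_zero_iff.2 (hmem w hw s hs').2.2))
      hs.1.le hs.2 (mem_closedBall_zero_iff.1 hw)
  · filter_upwards [hae] with s hs1 hs
    rw [uIoc_of_le zero_le_one] at hs
    have hs' : s ∈ Ioo (0 : ℝ) 1 := ⟨hs.1, lt_of_le_of_ne hs.2 hs1⟩
    have hsz := (hmem z hz s hs').2.2
    refine ContinuousAt.continuousWithinAt (ContinuousAt.div ?_ (by fun_prop) fun h0 => ?_)
    · exact ContinuousAt.comp (f := fun w : ℂ => (s : ℂ) * w) (hh.continuousOn.continuousAt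
        (isOpen_ball.mem_nhds (mem_ball_zero_iff.2 hsz))) (by fun_prop)
    · have := one_sub_le_norm_one_sub_mul ht0 hs.1.le hs.2 (mem_closedBall_zero_iff.1 hz)
      rw [h0, norm_zero] at this
      linarith

lemma norm_cesaro_sub_le {t : ℝ} (ht0 : 0 ≤ t) (ht1 : t < 1) {f h : ℂ → ℂ}
    (hf : DifferentiableOn ℂ f (ball 0 1)) (hh : DifferentiableOn ℂ h (ball 0 1))
    (hfb : ∀ z ∈ ball (0 : ℂ) 1, ‖f z‖ ≤ 1) (hhb : ∀ z ∈ ball (0 : ℂ) 1, ‖h z‖ ≤ 1)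
    {r δ : ℝ} (hr0 : 0 ≤ r) (hr1 : r ≤ 1) (hδ : ∀ z ∈ closedBall (0 : ℂ) r, ‖f z - h z‖ ≤ δ)
    {z : ℂ} (hz : z ∈ ball (0 : ℂ) 1) :
    ‖cesaro t f z - cesaro t h z‖ ≤ (δ + 2 * (1 - r)) / (1 - t) := by
  have hz1 := mem_ball_zero_iff.1 hz
  have ht : 0 < 1 - t := sub_pos.2 ht1
  have hmem : ∀ s ∈ Icc (0 : ℝ) 1, 0 ≤ s ∧ s ≤ 1 ∧ ‖(s : ℂ) * z‖ < 1 := fun s hs =>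
    ⟨hs.1, hs.2, norm_ofReal_mul_lt_one hs.1 hs.2 hz1.le (Or.inr hz1)⟩
  have hint : ∀ {u : ℂ → ℂ}, DifferentiableOn ℂ u (ball 0 1) → ∀ a ∈ Icc (0 : ℝ) 1,
      ∀ b ∈ Icc (0 : ℝ) 1, IntervalIntegrable
        (fun s : ℝ => u ((s : ℂ) * z) / (1 - (s : ℂ) * (t : ℂ) * z)) volume a b :=
    fun hu a ha b hb => ((continuousOn_cesaro_integrand ht0 ht1 hu hz1.le hmem).mono
      (uIcc_subset_Icc ha hb)).intervalIntegrable
  have h0 : (0 : ℝ) ∈ Icc (0 : ℝ) 1 := ⟨le_rfl, zero_le_one⟩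
  have h1 : (1 : ℝ) ∈ Icc (0 : ℝ) 1 := ⟨zero_le_one, le_rfl⟩
  have hr : r ∈ Icc (0 : ℝ) 1 := ⟨hr0, hr1⟩
  have hsub : DifferentiableOn ℂ (fun w => f w - h w) (ball 0 1) := hf.sub hh
  have heq : cesaro t f z - cesaro t h z =
      (∫ s in (0 : ℝ)..r, (f ((s : ℂ) * z) - h ((s : ℂ) * z)) / (1 - (s : ℂ) * (t : ℂ) * z)) +
      ∫ s in r..1, (f ((s : ℂ) * z) - h ((s : ℂ) * z)) / (1 - (s : ℂ) * (t : ℂ) * z) := by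
    rw [intervalIntegral.integral_add_adjacent_intervals (hint hsub 0 h0 r hr)
      (hint hsub r hr 1 h1), cesaro, cesaro,
      ← intervalIntegral.integral_sub (hint hf 0 h0 1 h1) (hint hh 0 h0 1 h1)]
    simp only [sub_div]
  have hδ0 : 0 ≤ δ := (norm_nonneg _).trans (hδ 0 (mem_closedBall_self hr0))
  have hA := intervalIntegral.norm_integral_le_of_norm_le_const (a := 0) (b := r)
    (C := δ / (1 - t))
    (f := fun s : ℝ => (f ((s : ℂ) * z) - h ((s : ℂ) * z)) / (1 - (s : ℂ) * (t : ℂ) * z))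
    (fun s hs => by
      rw [uIoc_of_le hr0] at hs
      refine norm_cesaro_integrand_le ht0 ht1 (hδ _ (mem_closedBall_zero_iff.2 ?_)) hs.1.le
        (hs.2.trans hr1) hz1.le
      rw [norm_mul, Complex.norm_of_nonneg hs.1.le]
      nlinarith [hs.1, hs.2, norm_nonneg z])
  have hB := intervalIntegral.norm_integral_le_of_norm_le_const (a := r) (b := 1)
    (C := 2 / (1 - t))
    (f := fun s : ℝ => (f ((s : ℂ) * z) - h ((s : ℂ) * z)) / (1 - (s : ℂ) * (t : ℂ) * z))
    (fun s hs => by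
      rw [uIoc_of_le hr1] at hs
      have hs0 : 0 ≤ s := hr0.trans hs.1.le
      have hsz := mem_ball_zero_iff.2 (hmem s ⟨hs0, hs.2⟩).2.2
      refine norm_cesaro_integrand_le ht0 ht1 ?_ hs0 hs.2 hz1.le
      linarith [norm_sub_le (f ((s : ℂ) * z)) (h ((s : ℂ) * z)), hfb _ hsz, hhb _ hsz])
  rw [sub_zero, abs_of_nonneg hr0] at hA
  rw [abs_of_nonneg (sub_nonneg.2 hr1)] at hB
  have hA' : δ / (1 - t) * r ≤ δ / (1 - t) := mul_le_of_le_one_right (by positivity) hr1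
  rw [heq, add_div, mul_div_right_comm]
  exact (norm_add_le _ _).trans (add_le_add (hA.trans hA') hB)

lemma MemHinf.norm_le_one {f : ℂ → ℂ} (hf : MemHinf f) (h1 : supNorm f ≤ 1) :
    ∀ z ∈ ball (0 : ℂ) 1, ‖f z‖ ≤ 1 := fun _ hz =>
  (le_csSup hf.2 (mem_image_of_mem (fun z => ‖f z‖) hz)).trans h1

lemma MemDiscAlg.memHinf {f : ℂ → ℂ} (hf : MemDiscAlg f) : MemHinf f :=
  ⟨hf.1, ((isCompact_closedBall (0 : ℂ) 1).bddAbove_image hf.2.norm).mono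
    (image_mono ball_subset_closedBall)⟩

lemma exists_subseq_tendsto_supNorm_cesaro {t : ℝ} (ht0 : 0 ≤ t) (ht1 : t < 1) {f : ℕ → ℂ → ℂ}
    (hf : ∀ n, MemHinf (f n) ∧ supNorm (f n) ≤ 1) :
    ∃ g, MemDiscAlg g ∧ ∃ φ : ℕ → ℕ, StrictMono φ ∧
      Tendsto (fun n => supNorm (fun z => cesaro t (f (φ n)) z - g z)) atTop (𝓝 0) := by
  have hd := fun n => (hf n).1.1
  have hb := fun n => (hf n).1.norm_le_one (hf n).2
  obtain ⟨h, φ, hφ, hlim⟩ := exists_subseq_tendstoUniformlyOn hd hb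
  have hloc : TendstoLocallyUniformlyOn (fun n => f (φ n)) h atTop (ball 0 1) := by
    rw [tendstoLocallyUniformlyOn_iff_forall_isCompact isOpen_ball]
    intro K hK hKc
    obtain ⟨r, hr, hKr⟩ := exists_lt_subset_ball hKc.isClosed hK
    exact (hlim r hr).mono (hKr.trans ball_subset_closedBall)
  have hh : DifferentiableOn ℂ h (ball 0 1) :=
    hloc.differentiableOn (Eventually.of_forall fun n => hd (φ n)) isOpen_ball
  have hhb : ∀ z ∈ ball (0 : ℂ) 1, ‖h z‖ ≤ 1 := fun z hz =>
    le_of_tendsto (hloc.tendsto_at hz).norm (Eventually.of_forall fun n => hb (φ n) z hz)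
  refine ⟨cesaro t h, ⟨differentiableOn_cesaro ht0 ht1 hh, continuousOn_cesaro ht0 ht1 hh hhb⟩,
    φ, hφ, ?_⟩
  have ht : 0 < 1 - t := sub_pos.2 ht1
  rw [Metric.tendsto_nhds]
  intro ε hε
  set η := min 1 (ε * (1 - t) / 4) with hη
  have hη0 : 0 < η := by positivity
  have hη1 : η ≤ 1 := min_le_left _ _
  have hη2 : η ≤ ε * (1 - t) / 4 := min_le_right _ _
  filter_upwards [Metric.tendstoUniformlyOn_iff.1 (hlim (1 - η) (by linarith)) η hη0] with n hn
  have hle : supNorm (fun z => cesaro t (f (φ n)) z - cesaro t h z) ≤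
      (η + 2 * (1 - (1 - η))) / (1 - t) := by
    refine csSup_le ((nonempty_ball.2 one_pos).image _) ?_
    rintro _ ⟨z, hz, rfl⟩
    refine norm_cesaro_sub_le ht0 ht1 (hd _) hh (hb _) hhb (sub_nonneg.2 hη1) (by linarith)
      (fun w hw => ?_) hz
    rw [← dist_eq_norm, dist_comm]
    exact (hn w hw).le
  have h0 : 0 ≤ supNorm (fun z => cesaro t (f (φ n)) z - cesaro t h z) := by
    refine Real.sSup_nonneg ?_
    rintro _ ⟨z, -, rfl⟩
    exact norm_nonneg _
  rw [Real.dist_eq, sub_zero, abs_of_nonneg h0]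
  refine hle.trans_lt ((div_lt_iff₀ ht).2 ?_)
  nlinarith [mul_pos hε ht]

/-- For each `t ∈ [0,1)`, the operator `C_t` is compact both on `H^∞` and on the disc
algebra `A(𝔻)`: every sequence in the closed unit ball has a subsequence whose image
under `C_t` converges in the sup norm to an element of the space (i.e. `C_t` maps the
closed unit ball to a relatively compact set). -/
theorem cesaro_compact_Hinf_discAlg (t : ℝ) (ht0 : 0 ≤ t) (ht1 : t < 1) :
    (∀ f : ℕ → ℂ → ℂ, (∀ n, MemHinf (f n) ∧ supNorm (f n) ≤ 1) →
      ∃ g, MemHinf g ∧ ∃ φ : ℕ → ℕ, StrictMono φ ∧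
        Tendsto (fun n => supNorm (fun z => cesaro t (f (φ n)) z - g z)) atTop (𝓝 0)) ∧
    (∀ f : ℕ → ℂ → ℂ, (∀ n, MemDiscAlg (f n) ∧ supNorm (f n) ≤ 1) →
      ∃ g, MemDiscAlg g ∧ ∃ φ : ℕ → ℕ, StrictMono φ ∧
        Tendsto (fun n => supNorm (fun z => cesaro t (f (φ n)) z - g z)) atTop (𝓝 0)) := by
  refine ⟨fun f hf => ?_, fun f hf => ?_⟩
  · obtain ⟨g, hg, hφ⟩ := exists_subseq_tendsto_supNorm_cesaro ht0 ht1 hf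
    exact ⟨g, hg.memHinf, hφ⟩
  · exact exists_subseq_tendsto_supNorm_cesaro ht0 ht1 fun n => ⟨(hf n).1.memHinf, (hf n).2⟩
end

section
/- Let 1 ≤ p < ∞. The Hardy operator C_0, defined by (C_0 f)(0) = f(0) and (C_0 f)(z) = (1/z)∫_0^z f(ξ) dξ for z ≠ 0, maps H^p continuously into itself, and its operator norm is exactly 1: ‖C_0 f‖_p ≤ ‖f‖_p for all f ∈ H^p, with equality attained at the constant function 1. -/
open Complex MeasureTheory Metric Set Filter Topology

/-- The integral means `M_p(r, f)`. -/
noncomputable def Mp (p : ℝ) (r : ℝ) (f : ℂ → ℂ) : ℝ :=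
  ((1 / (2 * Real.pi)) *
    ∫ θ in (0:ℝ)..(2 * Real.pi), ‖f ((r : ℂ) * Complex.exp ((θ : ℂ) * Complex.I))‖ ^ p) ^ (1 / p)

/-- The Hardy space norm `‖f‖_p = sup_{0 ≤ r < 1} M_p(r, f)`. -/
noncomputable def hardyNorm (p : ℝ) (f : ℂ → ℂ) : ℝ :=
  sSup ((fun r => Mp p r f) '' Set.Ico (0:ℝ) 1)

/-- Membership in the Hardy space `H^p`: holomorphic on the unit disc with bounded
integral means. -/
def MemHp (p : ℝ) (f : ℂ → ℂ) : Prop :=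
  DifferentiableOn ℂ f (Metric.ball (0:ℂ) 1) ∧
    BddAbove ((fun r => Mp p r f) '' Set.Ico (0:ℝ) 1)

theorem cesaro_zero_apply (f : ℂ → ℂ) (z : ℂ) :
    cesaro 0 f z = ∫ s in (0:ℝ)..1, f ((s : ℂ) * z) := by
  simp [cesaro]

/-- The Hardy operator is the divided difference at `0` of a primitive. -/
theorem differentiableOn_cesaro_zero {f : ℂ → ℂ} (hf : DifferentiableOn ℂ f (ball 0 1)) :
    DifferentiableOn ℂ (cesaro 0 f) (ball 0 1) := by
  obtain ⟨F, hF⟩ := hf.isExactOn_ball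
  have hFd : DifferentiableOn ℂ F (ball 0 1) :=
    fun z hz => (hF z hz).differentiableAt.differentiableWithinAt
  refine ((Complex.differentiableOn_dslope (ball_mem_nhds 0 one_pos)).2 hFd).congr fun z hz => ?_
  rw [cesaro_zero_apply]
  rcases eq_or_ne z 0 with rfl | hz0
  · simp [(hF 0 hz).deriv]
  · have hmem : ∀ s ∈ uIcc (0:ℝ) 1, (s : ℂ) * z ∈ ball (0:ℂ) 1 := by
      intro s hs
      rw [uIcc_of_le zero_le_one] at hs
      rw [mem_ball_zero_iff] at hz ⊢
      rw [norm_mul, norm_real, Real.norm_of_nonneg hs.1]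
      exact (mul_le_of_le_one_left (norm_nonneg z) hs.2).trans_lt hz
    have hcont : ContinuousOn (fun s : ℝ => f ((s : ℂ) * z)) (uIcc 0 1) :=
      hf.continuousOn.comp (by fun_prop) hmem
    have hder : ∀ s ∈ uIcc (0:ℝ) 1,
        HasDerivAt (fun s : ℝ => F ((s : ℂ) * z)) (f ((s : ℂ) * z) * z) s := by
      intro s hs
      have hlin : HasDerivAt (fun s : ℝ => (s : ℂ) * z) z s := by
        simpa using (ofRealCLM.hasDerivAt (x := s)).mul_const z
      exact (hF _ (hmem s hs)).comp s hlin
    have hftc := intervalIntegral.integral_eq_sub_of_hasDerivAt hder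
      (hcont.mul continuousOn_const).intervalIntegrable
    rw [intervalIntegral.integral_mul_const] at hftc
    rw [dslope_of_ne _ hz0, slope_def_field, sub_zero, eq_div_iff hz0, hftc]
    simp

/-- Jensen's inequality for the power `p ≥ 1` on the unit interval. -/
theorem norm_integral_rpow_le {p : ℝ} (hp : 1 ≤ p) {g : ℝ → ℂ}
    (hg : ContinuousOn g (Icc 0 1)) :
    ‖∫ s in (0:ℝ)..1, g s‖ ^ p ≤ ∫ s in (0:ℝ)..1, ‖g s‖ ^ p := by
  have hp0 : 0 ≤ p := zero_le_one.trans hp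
  have : IsProbabilityMeasure (volume.restrict (Ioc (0:ℝ) 1)) := ⟨by simp⟩
  have hpow : ContinuousOn (fun s => ‖g s‖ ^ p) (Icc 0 1) :=
    hg.norm.rpow_const fun _ _ => Or.inr hp0
  refine (Real.rpow_le_rpow (norm_nonneg _)
    (intervalIntegral.norm_integral_le_integral_norm zero_le_one) hp0).trans ?_
  simp only [intervalIntegral.integral_of_le (zero_le_one' ℝ)]
  exact (convexOn_rpow hp).map_integral_le (Real.continuous_rpow_const hp0).continuousOn isClosed_Ici
    (ae_of_all _ fun s => norm_nonneg (g s))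
    (hg.norm.integrableOn_Icc.mono_set Ioc_subset_Icc_self)
    (hpow.integrableOn_Icc.mono_set Ioc_subset_Icc_self)

theorem mean_nonneg (p r : ℝ) (f : ℂ → ℂ) :
    0 ≤ (1 / (2 * Real.pi)) *
      ∫ θ in (0:ℝ)..(2 * Real.pi), ‖f ((r : ℂ) * Complex.exp ((θ : ℂ) * Complex.I))‖ ^ p :=
  mul_nonneg (by positivity) <|
    intervalIntegral.integral_nonneg Real.two_pi_pos.le fun _ _ => by positivity

theorem Mp_nonneg (p r : ℝ) (f : ℂ → ℂ) : 0 ≤ Mp p r f :=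
  Real.rpow_nonneg (mean_nonneg p r f) _

theorem integral_eq_Mp_rpow {p : ℝ} (hp : p ≠ 0) (r : ℝ) (f : ℂ → ℂ) :
    ∫ θ in (0:ℝ)..(2 * Real.pi), ‖f ((r : ℂ) * Complex.exp ((θ : ℂ) * Complex.I))‖ ^ p =
      2 * Real.pi * Mp p r f ^ p := by
  rw [Mp, ← Real.rpow_mul (mean_nonneg p r f), one_div_mul_cancel hp, Real.rpow_one, ← mul_assoc,
    mul_one_div_cancel Real.two_pi_pos.ne', one_mul]

theorem Mp_cesaro_zero_le {p : ℝ} (hp : 1 ≤ p) {f : ℂ → ℂ} (hfd : DifferentiableOn ℂ f (ball 0 1))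
    {K : ℝ} (hK : ∀ r ∈ Ico (0:ℝ) 1, Mp p r f ≤ K) {r : ℝ} (hr : r ∈ Ico (0:ℝ) 1) :
    Mp p r (cesaro 0 f) ≤ K := by
  have hf := hfd.continuousOn
  have hp0 : 0 < p := zero_lt_one.trans_le hp
  have hK0 : 0 ≤ K := (Mp_nonneg p r f).trans (hK r hr)
  have hsr : ∀ s ∈ Icc (0:ℝ) 1, s * r ∈ Ico (0:ℝ) 1 := fun s hs =>
    ⟨mul_nonneg hs.1 hr.1, (mul_le_of_le_one_left hr.1 hs.2).trans_lt hr.2⟩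
  have hmem : ∀ s ∈ Icc (0:ℝ) 1, ∀ θ : ℝ,
      (s : ℂ) * ((r : ℂ) * Complex.exp ((θ : ℂ) * Complex.I)) ∈ ball (0:ℂ) 1 := by
    intro s hs θ
    rw [mem_ball_zero_iff, ← mul_assoc, norm_mul, norm_exp_ofReal_mul_I, mul_one, ← ofReal_mul,
      norm_real, Real.norm_of_nonneg (hsr s hs).1]
    exact (hsr s hs).2
  set G : ℝ → ℝ → ℝ := fun θ s =>
    ‖f ((s : ℂ) * ((r : ℂ) * Complex.exp ((θ : ℂ) * Complex.I)))‖ ^ p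
  have hGc : ContinuousOn (Function.uncurry G) (univ ×ˢ Icc (0:ℝ) 1) := by
    refine ContinuousOn.rpow_const (ContinuousOn.norm ?_) fun _ _ => Or.inr hp0.le
    exact hf.comp (by fun_prop) fun x hx => hmem x.2 hx.2 x.1
  have hfc : ∀ θ : ℝ, ContinuousOn
      (fun s : ℝ => f ((s : ℂ) * ((r : ℂ) * Complex.exp ((θ : ℂ) * Complex.I)))) (Icc 0 1) :=
    fun θ => hf.comp (by fun_prop) fun s hs => hmem s hs θ
  have hGint : IntegrableOn (Function.uncurry G) (uIoc 0 (2 * Real.pi) ×ˢ uIoc 0 1)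
      (volume.prod volume) := by
    have hcpt : IsCompact (Icc 0 (2 * Real.pi) ×ˢ Icc (0:ℝ) 1) := isCompact_Icc.prod isCompact_Icc
    refine ((hGc.mono (prod_mono_left (subset_univ _))).integrableOn_compact hcpt).mono_set ?_
    rw [uIoc_of_le Real.two_pi_pos.le, uIoc_of_le zero_le_one]
    exact prod_mono Ioc_subset_Icc_self Ioc_subset_Icc_self
  have hswap : ∫ θ in (0:ℝ)..(2 * Real.pi), ∫ s in (0:ℝ)..1, G θ s =
      ∫ s in (0:ℝ)..1, ∫ θ in (0:ℝ)..(2 * Real.pi), G θ s :=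
    intervalIntegral_intervalIntegral_swap hGint
  have hGprod : Integrable (Function.uncurry G)
      ((volume.restrict (uIoc 0 (2 * Real.pi))).prod (volume.restrict (uIoc (0:ℝ) 1))) := by
    rwa [Measure.prod_restrict]
  have hcirc : ∀ θ : ℝ, (r : ℂ) * Complex.exp ((θ : ℂ) * Complex.I) ∈ ball (0:ℂ) 1 := by
    intro θ
    simpa using hmem 1 (right_mem_Icc.2 zero_le_one) θ
  have hCc : Continuous fun θ : ℝ =>
      ‖cesaro 0 f ((r : ℂ) * Complex.exp ((θ : ℂ) * Complex.I))‖ ^ p :=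
    ((differentiableOn_cesaro_zero hfd).continuousOn.comp_continuous (by fun_prop)
      hcirc).norm.rpow_const fun _ => Or.inr hp0.le
  have hinner : ∀ s ∈ Icc (0:ℝ) 1,
      ∫ θ in (0:ℝ)..(2 * Real.pi), G θ s ≤ 2 * Real.pi * K ^ p := by
    intro s hs
    have heq := integral_eq_Mp_rpow hp0.ne' (s * r) f
    simp only [ofReal_mul, mul_assoc (s : ℂ)] at heq
    rw [heq]
    have := Mp_nonneg p (s * r) f
    have := hK _ (hsr s hs)
    gcongr
  have hle : 2 * Real.pi * Mp p r (cesaro 0 f) ^ p ≤ 2 * Real.pi * K ^ p := by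
    rw [← integral_eq_Mp_rpow hp0.ne']
    calc _ ≤ ∫ θ in (0:ℝ)..(2 * Real.pi), ∫ s in (0:ℝ)..1, G θ s := by
          refine intervalIntegral.integral_mono_on Real.two_pi_pos.le
            (hCc.intervalIntegrable _ _) ?_ fun θ _ => ?_
          · rw [intervalIntegrable_iff]
            simpa only [intervalIntegral.integral_of_le (zero_le_one' ℝ),
              uIoc_of_le (zero_le_one' ℝ), IntegrableOn,
              Function.uncurry_apply_pair] using hGprod.integral_prod_left
          · rw [cesaro_zero_apply]
            exact norm_integral_rpow_le hp (hfc θ)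
      _ = ∫ s in (0:ℝ)..1, ∫ θ in (0:ℝ)..(2 * Real.pi), G θ s := hswap
      _ ≤ ∫ _ in (0:ℝ)..1, 2 * Real.pi * K ^ p := by
          refine intervalIntegral.integral_mono_on zero_le_one ?_ (by simp) hinner
          rw [intervalIntegrable_iff]
          simpa only [intervalIntegral.integral_of_le Real.two_pi_pos.le,
            uIoc_of_le Real.two_pi_pos.le, IntegrableOn,
              Function.uncurry_apply_pair] using hGprod.integral_prod_right
      _ = 2 * Real.pi * K ^ p := by simp
  exact (Real.rpow_le_rpow_iff (Mp_nonneg p r _) hK0 hp0).1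
    (le_of_mul_le_mul_left hle Real.two_pi_pos)

/-- For `1 ≤ p < ∞`, the Hardy operator `C_0` maps `H^p` continuously into itself with
`‖C_0 f‖_p ≤ ‖f‖_p`, and its operator norm is exactly `1`, equality being attained at
the constant function `1`. -/
theorem hardy_operator_continuous_norm_one (p : ℝ) (hp : 1 ≤ p) :
    (∀ f, MemHp p f →
      MemHp p (cesaro 0 f) ∧ hardyNorm p (cesaro 0 f) ≤ hardyNorm p f) ∧
    MemHp p (fun _ => (1:ℂ)) ∧ hardyNorm p (fun _ => (1:ℂ)) = 1 ∧
    hardyNorm p (cesaro 0 (fun _ => (1:ℂ))) = 1 := by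
  have hMp1 : ∀ r, Mp p r (fun _ => (1:ℂ)) = 1 := by
    intro r
    have : Real.pi ≠ 0 := Real.pi_ne_zero
    have h : 1 / (2 * Real.pi) * (2 * Real.pi) = 1 := by field_simp
    simp only [Mp, norm_one, Real.one_rpow, intervalIntegral.integral_const, sub_zero, smul_eq_mul,
      mul_one, h]
  have hne : (Ico (0:ℝ) 1).Nonempty := nonempty_Ico.2 one_pos
  have hnorm1 : hardyNorm p (fun _ => (1:ℂ)) = 1 := by
    simp only [hardyNorm, hMp1, hne.image_const, csSup_singleton]
  have hc1 : cesaro 0 (fun _ => (1:ℂ)) = fun _ => 1 := by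
    ext z
    simp [cesaro_zero_apply]
  refine ⟨fun f hf => ?_, ⟨differentiableOn_const _, ?_⟩, hnorm1, by rw [hc1, hnorm1]⟩
  · have hbound : ∀ r ∈ Ico (0:ℝ) 1, Mp p r (cesaro 0 f) ≤ hardyNorm p f := fun r hr =>
      Mp_cesaro_zero_le hp hf.1
        (fun r hr => le_csSup hf.2 (mem_image_of_mem _ hr)) hr
    exact ⟨⟨differentiableOn_cesaro_zero hf.1, _, forall_mem_image.2 hbound⟩,
      csSup_le (hne.image _) (forall_mem_image.2 hbound)⟩
  · simp only [hMp1, hne.image_const, bddAbove_singleton]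
end
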